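/- arXiv:2206.00589 — 11 statements merged into one kernel-verified Lean document; each statement's English description precedes it below -/
import Mathlib

section
/- A positive integer m is represented by the ternary quadratic form 2x^2 + 2xy + 2xz + 2y^2 + 2yz + 3z^2 (i.e., there exist integers x, y, z with 2x^2 + 2xy + 2xz + 2y^2 + 2yz + 3z^2 = m) if and only if m is not of the form 4^k(8ℓ + 1) for any nonnegative integers k and ℓ. -/
open NumberTheorySymbols in
/-- Reciprocity in the form `(-d / p) = (p / d)`. -/
theorem jacobiSym_neg_eq_jacobiSym_swap {p d : ℕ} (hd : Odd d)
    (h : p % 4 = 1 ∨ p % 4 = 3 ∧ d % 4 = 3) : J(-d | p) = J(p | d) := by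
  have hp : Odd p := Nat.odd_iff.2 (by omega)
  rw [jacobiSym.neg _ hp]
  rcases h with h | ⟨h, h'⟩
  · rw [ZMod.χ₄_nat_one_mod_four h, one_mul,
      jacobiSym.quadratic_reciprocity_one_mod_four' hd h]
  · rw [ZMod.χ₄_nat_three_mod_four h,
      jacobiSym.quadratic_reciprocity_three_mod_four h' h]
    ring

theorem exists_dvd_sq_add_of_mod_four_eq_two {n : ℕ} (hn : n % 4 = 2) :
    ∃ b t : ℤ, 0 < b * n - 1 ∧ b * n - 1 ∣ t ^ 2 + b := by
  have hcop : IsCoprime ((n : ℤ) - 1) ((4 * n : ℕ) : ℤ) := by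
    have hodd : IsCoprime ((n : ℤ) - 1) 2 := Int.isCoprime_two_right.2 (Int.odd_iff.2 (by omega))
    have hself : IsCoprime ((n : ℤ) - 1) n := ⟨-1, 1, by ring⟩
    push_cast
    exact (hodd.pow_right (n := 2)).mul_right hself
  obtain ⟨p, hpn, hp, hmod⟩ := Nat.forall_exists_prime_gt_and_zmodEq n (by omega) hcop
  have := Fact.mk hp
  obtain ⟨j, hj⟩ := hmod.symm.dvd
  push_cast at hj
  have hj0 : 0 ≤ j := by
    by_contra! h
    nlinarith
  lift j to ℕ using hj0
  have hp' : (p : ℤ) = ((4 * j + 1 : ℕ) : ℤ) * n - 1 := by push_cast; linarith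
  have hp4 : p % 4 = 1 := by
    have : (p : ℤ) = 4 * (n * j) + n - 1 := by linarith
    generalize (n * j : ℤ) = w at this
    omega
  have hd : Odd (4 * j + 1) := Nat.odd_iff.2 (by omega)
  have hJ : jacobiSym (-(4 * j + 1 : ℕ)) p = 1 := by
    rw [jacobiSym_neg_eq_jacobiSym_swap hd (.inl hp4), jacobiSym.mod_left' (a₂ := -1),
      jacobiSym.at_neg_one hd, ZMod.χ₄_nat_one_mod_four (by omega)]
    exact Int.ModEq.symm ((Int.modEq_iff_dvd).2 ⟨n, by rw [hp']; ring⟩)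
  obtain ⟨r, hr⟩ := ZMod.isSquare_of_jacobiSym_eq_one hJ
  obtain ⟨t, rfl⟩ := ZMod.intCast_surjective r
  refine ⟨(4 * j + 1 : ℕ), t, ?_, ?_⟩
  · rw [← hp']; exact_mod_cast hp.pos
  · rw [← hp', ← ZMod.intCast_zmod_eq_zero_iff_dvd]
    push_cast at hr ⊢
    linear_combination -hr

theorem exists_dvd_sq_add_of_odd {n : ℕ} (hn1 : 1 < n) (hn : n % 8 = 1 ∨ n % 8 = 3 ∨ n % 8 = 5) :
    ∃ b t : ℤ, 0 < b * n - 1 ∧ b * n - 1 ∣ t ^ 2 + b := by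
  obtain ⟨c, a, hc, ha, hca⟩ : ∃ c a : ℕ, (c = 1 ∨ c = 3) ∧ c * n = 2 * a + 1 ∧
      (a % 4 = 1 ∧ (c = 1 ∨ c = 3) ∨ a % 4 = 3 ∧ c = 3) := by
    rcases hn with h | h | h
    · exact ⟨3, (3 * n - 1) / 2, by omega, by omega, by omega⟩
    · exact ⟨1, (n - 1) / 2, by omega, by omega, by omega⟩
    · exact ⟨3, (3 * n - 1) / 2, by omega, by omega, by omega⟩
  have hcop : a.Coprime (4 * n) := by
    refine Nat.Coprime.mul_right ?_ ?_
    · exact (Nat.coprime_two_right.2 (Nat.odd_iff.2 (by omega))).pow_right 2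
    · refine Nat.Coprime.coprime_mul_left_right (k := c) ?_
      rw [ha]
      simp
  obtain ⟨p, hpn, hp, hmod⟩ := Nat.forall_exists_prime_gt_and_modEq (2 * a) (by omega) hcop
  have := Fact.mk hp
  obtain ⟨j, hj⟩ := (Nat.modEq_iff_dvd' (by omega)).1 hmod.symm
  replace hj : p = a + 4 * (n * j) := by rw [mul_assoc] at hj; omega
  set d : ℕ := 8 * j + c with hddef
  have hd : Odd d := Nat.odd_iff.2 (by omega)
  have hp' : (2 * p : ℤ) = d * n - 1 := by
    zify at ha hj
    rw [hj, hddef]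
    push_cast
    linear_combination -ha
  have hpd : p % 4 = 1 ∨ p % 4 = 3 ∧ d % 4 = 3 := by
    generalize n * j = w at hj
    omega
  have hJ : jacobiSym (-d) p = 1 := by
    rw [jacobiSym_neg_eq_jacobiSym_swap hd hpd]
    have h2 : jacobiSym (-2) d = 1 := by
      rw [jacobiSym.at_neg_two hd, ZMod.χ₈'_nat_eq_if_mod_eight]
      have : d % 8 = 1 ∨ d % 8 = 3 := by omega
      rw [if_neg (by omega), if_pos this]
    have h3 : jacobiSym (-2 * p) d = 1 := by
      rw [jacobiSym.mod_left' (a₂ := 1), jacobiSym.one_left]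
      exact (Int.modEq_iff_dvd).2 ⟨n, by linear_combination hp'⟩
    rwa [jacobiSym.mul_left, h2, one_mul] at h3
  obtain ⟨r, hr⟩ := ZMod.isSquare_of_jacobiSym_eq_one hJ
  obtain ⟨t, rfl⟩ := ZMod.intCast_surjective r
  have hpt : (p : ℤ) ∣ t ^ 2 + d := by
    rw [← ZMod.intCast_zmod_eq_zero_iff_dvd]
    push_cast at hr ⊢
    linear_combination -hr
  have hp2 : p % 2 = 1 := by omega
  have hcop2 : IsCoprime (2 : ℤ) p := by
    exact_mod_cast Nat.isCoprime_iff_coprime.2 (Nat.coprime_two_left.2 (Nat.odd_iff.2 hp2))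
  have hd2 : (d : ℤ) % 2 = 1 := by exact_mod_cast Nat.odd_iff.1 hd
  have hpos : (0 : ℤ) < 2 * p := by exact_mod_cast Nat.mul_pos two_pos hp.pos
  rw [hp'] at hpos
  rcases Int.even_or_odd t with ht | ht
  · refine ⟨d, t + p, hpos, ?_⟩
    rw [← hp']
    refine hcop2.mul_dvd ?_ ?_
    · obtain ⟨s, rfl⟩ := ht
      have : ((s + s + p) ^ 2 + d : ℤ) = 2 * (2 * s ^ 2 + 2 * s * p) + (p * p + d) := by ring
      rw [this]
      refine (dvd_mul_right _ _).add ?_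
      have : Odd (p * p) := (Nat.odd_iff.2 hp2).mul (Nat.odd_iff.2 hp2)
      exact_mod_cast (this.add_odd hd).two_dvd
    · have : ((t + p) ^ 2 + d : ℤ) = (t ^ 2 + d) + p * (2 * t + p) := by ring
      rw [this]
      exact hpt.add (dvd_mul_right _ _)
  · refine ⟨d, t, hpos, ?_⟩
    rw [← hp']
    refine hcop2.mul_dvd ?_ hpt
    exact (ht.pow.add_odd (Int.odd_iff.2 hd2)).two_dvd

/-- Every integer is congruent modulo `a > 0` to one of absolute value at most `a / 2`. -/
theorem exists_four_mul_add_mul_sq_le {a : ℤ} (ha : 0 < a) (b : ℤ) :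
    ∃ k : ℤ, 4 * (b + k * a) ^ 2 ≤ a ^ 2 := by
  refine ⟨-((2 * b + a) / (2 * a)), ?_⟩
  have h1 := Int.emod_add_mul_ediv (2 * b + a) (2 * a)
  have h2 := Int.emod_nonneg (2 * b + a) (by omega : 2 * a ≠ 0)
  have h3 := Int.emod_lt_of_pos (2 * b + a) (by omega : 0 < 2 * a)
  generalize (2 * b + a) / (2 * a) = q at *
  generalize (2 * b + a) % (2 * a) = r at *
  have : 2 * (b + -q * a) = r - a := by linear_combination -h1
  nlinarith

/-- Gauss reduction: a positive definite binary form `a y² + 2 b y z + c z²` primitively represents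
a positive integer at most `√(4 (ac - b²) / 3)`. -/
theorem exists_unimodular_three_mul_sq_le {a b c : ℤ} (ha : 0 < a) (hD : 0 < a * c - b ^ 2) :
    ∃ p q r s : ℤ, p * s - q * r = 1 ∧ 0 < a * p ^ 2 + 2 * b * p * r + c * r ^ 2 ∧
      3 * (a * p ^ 2 + 2 * b * p * r + c * r ^ 2) ^ 2 ≤ 4 * (a * c - b ^ 2) := by
  induction h : a.toNat using Nat.strong_induction_on generalizing a b c with
  | _ N ih =>
  subst h
  obtain ⟨k, hk⟩ := exists_four_mul_add_mul_sq_le ha b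
  set c' := a * k ^ 2 + 2 * b * k + c with hc'
  have hD' : a * c' - (b + k * a) ^ 2 = a * c - b ^ 2 := by rw [hc']; ring
  have hc0 : 0 < c' := by
    have : 0 < a * c' := by nlinarith [sq_nonneg (b + k * a)]
    exact pos_of_mul_pos_right this ha.le
  by_cases hlt : c' < a
  · obtain ⟨p, q, r, s, h1, h2, h3⟩ := ih c'.toNat (by omega) (a := c') (b := -(b + k * a)) (c := a)
      hc0 (by linarith) rfl
    have key : c' * p ^ 2 + 2 * -(b + k * a) * p * r + a * r ^ 2 =
        a * (k * p - r) ^ 2 + 2 * b * (k * p - r) * p + c * p ^ 2 := by rw [hc']; ring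
    rw [key] at h2 h3
    refine ⟨k * p - r, k * q - s, p, q, by linear_combination h1, h2, ?_⟩
    linarith
  · refine ⟨1, 0, 0, 1, by norm_num, by simpa using ha, ?_⟩
    push Not at hlt
    nlinarith

/-- Hermite reduction: a positive definite ternary form of determinant one is equivalent to one with
the same leading coefficient `a` whose other coefficients are bounded in terms of `a`. -/
theorem exists_reduced_of_det_eq_one {a b c d e f : ℤ} (ha : 0 < a) (hab : 0 < a * b - f ^ 2)
    (hdet : a * b * c + 2 * d * e * f - a * d ^ 2 - b * e ^ 2 - c * f ^ 2 = 1) :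
    ∃ b' c' d' e' f' : ℤ, 0 < a * b' - f' ^ 2 ∧ 3 * (a * b' - f' ^ 2) ^ 2 ≤ 4 * a ∧
      4 * f' ^ 2 ≤ a ^ 2 ∧ 4 * e' ^ 2 ≤ a ^ 2 ∧
      a * b' * c' + 2 * d' * e' * f' - a * d' ^ 2 - b' * e' ^ 2 - c' * f' ^ 2 = 1 ∧
      ∀ x y z : ℤ, ∃ X Y Z : ℤ,
        a * x ^ 2 + b * y ^ 2 + c * z ^ 2 + 2 * d * y * z + 2 * e * x * z + 2 * f * x * y =
          a * X ^ 2 + b' * Y ^ 2 + c' * Z ^ 2 + 2 * d' * Y * Z + 2 * e' * X * Z + 2 * f' * X * Y := by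
  have hDg : (a * b - f ^ 2) * (a * c - e ^ 2) - (a * d - e * f) ^ 2 = a := by
    linear_combination a * hdet
  obtain ⟨p, q, r, s, hu, hA, hA'⟩ := exists_unimodular_three_mul_sq_le hab (hDg ▸ ha)
  rw [hDg] at hA'
  set A := (a * b - f ^ 2) * p ^ 2 + 2 * (a * d - e * f) * p * r + (a * c - e ^ 2) * r ^ 2 with hAdef
  obtain ⟨k, hk⟩ := exists_four_mul_add_mul_sq_le ha (f * p + e * r)
  obtain ⟨l, hl⟩ := exists_four_mul_add_mul_sq_le ha (f * q + e * s)
  set f' := f * p + e * r + k * a with hf'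
  set e' := f * q + e * s + l * a with he'
  set b' := b * p ^ 2 + 2 * d * p * r + c * r ^ 2 + 2 * k * (f * p + e * r) + k ^ 2 * a with hb'
  set c' := b * q ^ 2 + 2 * d * q * s + c * s ^ 2 + 2 * l * (f * q + e * s) + l ^ 2 * a with hc'
  set d' := b * p * q + d * (p * s + q * r) + c * r * s + k * (f * q + e * s) +
    l * (f * p + e * r) + k * l * a with hd'
  have hbA : a * b' - f' ^ 2 = A := by rw [hb', hAdef, hf']; ring
  have hdet' : a * b' * c' + 2 * d' * e' * f' - a * d' ^ 2 - b' * e' ^ 2 - c' * f' ^ 2 = 1 := by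
    have : a * b' * c' + 2 * d' * e' * f' - a * d' ^ 2 - b' * e' ^ 2 - c' * f' ^ 2 =
        (a * b * c + 2 * d * e * f - a * d ^ 2 - b * e ^ 2 - c * f ^ 2) * (p * s - q * r) ^ 2 := by
      rw [hb', hc', hd', he', hf']; ring
    rw [this, hdet, hu]; norm_num
  refine ⟨b', c', d', e', f', hbA ▸ hA, hbA ▸ hA', hk, hl, hdet', fun x y z => ?_⟩
  obtain ⟨Y, Z, hY, hZ⟩ : ∃ Y Z, y = p * Y + q * Z ∧ z = r * Y + s * Z :=
    ⟨s * y - q * z, p * z - r * y, by linear_combination -y * hu, by linear_combination -z * hu⟩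
  refine ⟨x - k * Y - l * Z, Y, Z, ?_⟩
  rw [hY, hZ, hb', hc', hd', he', hf']
  ring

/-- A positive definite ternary form of determinant one represents only sums of three squares. -/
theorem exists_sum_three_sq_of_det_eq_one {a b c d e f : ℤ} (ha : 0 < a) (hab : 0 < a * b - f ^ 2)
    (hdet : a * b * c + 2 * d * e * f - a * d ^ 2 - b * e ^ 2 - c * f ^ 2 = 1) (x y z : ℤ) :
    ∃ u v w : ℤ, a * x ^ 2 + b * y ^ 2 + c * z ^ 2 + 2 * d * y * z + 2 * e * x * z + 2 * f * x * y =
      u ^ 2 + v ^ 2 + w ^ 2 := by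
  induction h : a.toNat using Nat.strong_induction_on generalizing a b c d e f x y z with
  | _ N ih =>
  subst h
  obtain ⟨b', c', d', e', f', hA, hA', hk, hl, hdet', hform⟩ :=
    exists_reduced_of_det_eq_one ha hab hdet
  obtain ⟨X, Y, Z, hform⟩ := hform x y z
  rw [hform]
  obtain ⟨A, hbA⟩ : ∃ A, a * b' = A + f' ^ 2 := ⟨a * b' - f' ^ 2, by ring⟩
  rw [hbA, add_sub_cancel_right] at hA hA'
  have hb0 : 0 < b' := pos_of_mul_pos_right (by rw [hbA]; positivity : 0 < a * b') ha.le
  by_cases hlt : b' < a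
  · obtain ⟨u, v, w, h⟩ := ih b'.toNat (by omega) (a := b') (b := a) (c := c') (d := e') (e := d')
      (f := f') hb0 (by linarith) (by linear_combination hdet') Y X Z rfl
    exact ⟨u, v, w, by linear_combination h⟩
  · push Not at hlt
    have h1 : 3 * a ^ 2 ≤ 4 * A := by linarith [mul_le_mul_of_nonneg_left hlt ha.le]
    have h2 : a = 1 := by
      by_contra hne
      have ha2 : 2 ≤ a := by omega
      have h3 : (3 * a ^ 2) ^ 2 ≤ (4 * A) ^ 2 := pow_le_pow_left₀ (by positivity) h1 2
      have h4 : a * 8 ≤ a * a ^ 3 := by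
        have : 2 ^ 3 ≤ a ^ 3 := pow_le_pow_left₀ (by norm_num) ha2 3
        exact mul_le_mul_of_nonneg_left this ha.le
      linarith
    subst h2
    have hA1 : A = 1 := by
      have : A < 2 := by
        by_contra! h2
        linarith [pow_le_pow_left₀ (by norm_num) h2 2]
      omega
    have hf0 : f' = 0 := pow_eq_zero_iff two_ne_zero |>.1 (by have := sq_nonneg f'; omega)
    have he0 : e' = 0 := pow_eq_zero_iff two_ne_zero |>.1 (by have := sq_nonneg e'; omega)
    subst hA1 hf0 he0
    have hb1 : b' = 1 := by linarith
    subst hb1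
    exact ⟨X, Y + d' * Z, Z, by linear_combination Z ^ 2 * hdet'⟩

theorem exists_sum_three_sq_of_dvd {n b t : ℤ} (hpos : 0 < b * n - 1) (hb : 0 < b)
    (hdvd : b * n - 1 ∣ t ^ 2 + b) : ∃ u v w : ℤ, n = u ^ 2 + v ^ 2 + w ^ 2 := by
  obtain ⟨a, ha⟩ := hdvd
  have ha0 : 0 < a := pos_of_mul_pos_right (by rw [← ha]; positivity : 0 < (b * n - 1) * a) hpos.le
  obtain ⟨u, v, w, h⟩ := exists_sum_three_sq_of_det_eq_one (a := a) (b := b * n - 1) (c := n)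
    (d := 0) (e := 1) (f := t) ha0 (by linarith) (by linear_combination -n * ha) 0 0 1
  exact ⟨u, v, w, by linear_combination h⟩

/-- **Legendre's three squares theorem**, for integers not divisible by four. -/
theorem exists_sum_three_sq {n : ℕ} (h4 : n % 4 ≠ 0) (h7 : n % 8 ≠ 7) :
    ∃ u v w : ℤ, (n : ℤ) = u ^ 2 + v ^ 2 + w ^ 2 := by
  obtain rfl | hn1 : n = 1 ∨ 1 < n := by omega
  · exact ⟨1, 0, 0, by norm_num⟩
  obtain ⟨b, t, hpos, hdvd⟩ : ∃ b t : ℤ, 0 < b * n - 1 ∧ b * n - 1 ∣ t ^ 2 + b := by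
    by_cases h2 : n % 4 = 2
    · exact exists_dvd_sq_add_of_mod_four_eq_two h2
    · exact exists_dvd_sq_add_of_odd hn1 (by omega)
  exact exists_sum_three_sq_of_dvd hpos
    (pos_of_mul_pos_left (by linarith : 0 < b * n) (by positivity)) hdvd

theorem four_pow_mul_ne_sum_three_sq (k : ℕ) {n : ℤ} (hn : n % 8 = 7) (u v w : ℤ) :
    4 ^ k * n ≠ u ^ 2 + v ^ 2 + w ^ 2 := by
  have sq_mod (t : ℤ) : t % 2 = 0 ∧ t ^ 2 % 4 = 0 ∧ (t ^ 2 % 8 = 0 ∨ t ^ 2 % 8 = 4) ∨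
      t ^ 2 % 8 = 1 := by
    have : t % 8 = 0 ∨ t % 8 = 1 ∨ t % 8 = 2 ∨ t % 8 = 3 ∨ t % 8 = 4 ∨ t % 8 = 5 ∨ t % 8 = 6 ∨
      t % 8 = 7 := by omega
    have h8 : t ^ 2 % 8 = (t % 8) ^ 2 % 8 := by rw [pow_two, Int.mul_emod, ← pow_two]
    rcases this with h | h | h | h | h | h | h | h <;> rw [h] at h8 <;> norm_num at h8 <;> omega
  induction k generalizing u v w with
  | zero =>
    have := sq_mod u
    have := sq_mod v
    have := sq_mod w
    omega
  | succ k ih =>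
    intro h
    have hu := sq_mod u
    have hv := sq_mod v
    have hw := sq_mod w
    rw [pow_succ, mul_right_comm, mul_comm] at h
    obtain ⟨u, rfl⟩ : (2 : ℤ) ∣ u := by omega
    obtain ⟨v, rfl⟩ : (2 : ℤ) ∣ v := by omega
    obtain ⟨w, rfl⟩ : (2 : ℤ) ∣ w := by omega
    exact ih u v w (by linarith)

/-- Up to signs and order, an isotropic vector for `X² + Y² + Z²` over `ZMod 7` is a multiple of
`(1, 2, 3)`. -/
theorem ZMod.isotropic_seven (X Y Z : ZMod 7) (h : X ^ 2 + Y ^ 2 + Z ^ 2 = 0) :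
    ((Y = 2 * X ∨ -Y = 2 * X) ∧ (Z = 3 * X ∨ -Z = 3 * X)) ∨
      ((Z = 2 * X ∨ -Z = 2 * X) ∧ (Y = 3 * X ∨ -Y = 3 * X)) := by
  revert X Y Z
  decide

/-- The form takes the value `m` iff `7 m` is a sum of three squares. -/
theorem exists_form_eq_iff_exists_sum_three_sq (m : ℤ) :
    (∃ x y z : ℤ, 2*x^2 + 2*x*y + 2*x*z + 2*y^2 + 2*y*z + 3*z^2 = m) ↔
      ∃ u v w : ℤ, 7 * m = u ^ 2 + v ^ 2 + w ^ 2 := by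
  constructor
  · rintro ⟨x, y, z, rfl⟩
    exact ⟨x - 2 * y + 2 * z, 2 * x + 3 * y + 4 * z, 3 * x + y - z, by ring⟩
  · have of_congr (X Y Z : ℤ) (h : 7 * m = X ^ 2 + Y ^ 2 + Z ^ 2) (hY : (Y : ZMod 7) = 2 * X)
        (hZ : (Z : ZMod 7) = 3 * X) :
        ∃ x y z : ℤ, 2*x^2 + 2*x*y + 2*x*z + 2*y^2 + 2*y*z + 3*z^2 = m := by
      obtain ⟨y, hy⟩ : ((7 : ℕ) : ℤ) ∣ Y - 2 * X := by
        rw [← ZMod.intCast_zmod_eq_zero_iff_dvd]; push_cast; rw [hY, sub_self]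
      obtain ⟨w, hw⟩ : ((7 : ℕ) : ℤ) ∣ Z - 3 * X := by
        rw [← ZMod.intCast_zmod_eq_zero_iff_dvd]; push_cast; rw [hZ, sub_self]
      push_cast at hy hw
      obtain rfl : Y = 2 * X + 7 * y := by linarith
      obtain rfl : Z = 3 * X + 7 * w := by linarith
      exact ⟨X + 2 * y - 2 * (y - w), y, y - w, by linarith⟩
    rintro ⟨X, Y, Z, h⟩
    have h7 : (X : ZMod 7) ^ 2 + (Y : ZMod 7) ^ 2 + (Z : ZMod 7) ^ 2 = 0 := by
      have := congrArg (Int.cast : ℤ → ZMod 7) h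
      push_cast at this
      rw [← this, show (7 : ZMod 7) = 0 from rfl, zero_mul]
    rcases ZMod.isotropic_seven _ _ _ h7 with ⟨hY | hY, hZ | hZ⟩ | ⟨hY | hY, hZ | hZ⟩
    · exact of_congr X Y Z h hY hZ
    · exact of_congr X Y (-Z) (by linarith) hY (by simpa using hZ)
    · exact of_congr X (-Y) Z (by linarith) (by simpa using hY) hZ
    · exact of_congr X (-Y) (-Z) (by linarith) (by simpa using hY) (by simpa using hZ)
    · exact of_congr X Z Y (by linarith) hY hZ
    · exact of_congr X Z (-Y) (by linarith) hY (by simpa using hZ)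
    · exact of_congr X (-Z) Y (by linarith) (by simpa using hY) hZ
    · exact of_congr X (-Z) (-Y) (by linarith) (by simpa using hY) (by simpa using hZ)

theorem stmt_0 (m : ℕ) (hm : 0 < m) :
    (∃ x y z : ℤ, 2*x^2 + 2*x*y + 2*x*z + 2*y^2 + 2*y*z + 3*z^2 = (m : ℤ)) ↔ ¬ ∃ k l : ℕ, m = 4 ^ k * (8 * l + 1) := by
  rw [exists_form_eq_iff_exists_sum_three_sq]
  constructor
  · rintro ⟨u, v, w, h⟩ ⟨k, l, rfl⟩
    refine four_pow_mul_ne_sum_three_sq k (n := 7 * (8 * l + 1)) (by omega) u v w ?_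
    rw [← h]
    push_cast
    ring
  · intro h
    obtain ⟨k, n, hn, rfl⟩ := Nat.exists_eq_pow_mul_and_not_dvd hm.ne' 4 (by norm_num)
    have hn1 : n % 8 ≠ 1 := fun h1 => h ⟨k, n / 8, by congr 1; omega⟩
    obtain ⟨u, v, w, h⟩ := exists_sum_three_sq (n := 7 * n) (by omega) (by omega)
    refine ⟨2 ^ k * u, 2 ^ k * v, 2 ^ k * w, ?_⟩
    push_cast at h ⊢
    rw [show (4 : ℤ) = 2 ^ 2 by norm_num, ← pow_mul]
    linear_combination 2 ^ (2 * k) * h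
end

section
/- A positive integer m is represented by the ternary quadratic form x^2 + 2y^2 + 2yz + 6z^2 (i.e., there exist integers x, y, z with x^2 + 2y^2 + 2yz + 6z^2 = m) if and only if m is not of the form 4^k(8ℓ + 5) for any nonnegative integers k and ℓ. -/
open scoped NumberTheorySymbols

theorem exists_abs_two_mul_add_mul_le (a t : ℤ) (ha : 0 < a) :
    ∃ k : ℤ, 4 * (t + k * a) ^ 2 ≤ a ^ 2 := by
  have h1 := Int.emod_nonneg t ha.ne'
  have h2 := Int.emod_lt_of_pos t ha
  have h3 := Int.emod_add_mul_ediv t a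
  by_cases h : 2 * (t % a) ≤ a
  · refine ⟨-(t / a), ?_⟩
    have : t + -(t / a) * a = t % a := by linarith
    rw [this]
    nlinarith
  · refine ⟨-(t / a) - 1, ?_⟩
    have : t + (-(t / a) - 1) * a = t % a - a := by linarith
    rw [this]
    nlinarith

/-- Reduction of a positive definite binary form: after a unimodular substitution the leading
coefficient is small compared with the determinant. -/
theorem exists_unimodular_binary_reduced (A B C : ℤ) (hA : 0 < A) (hD : 0 < A * C - B ^ 2) :
    ∃ p q u v : ℤ, p * v - q * u = 1 ∧ 0 < A * p ^ 2 + 2 * B * p * u + C * u ^ 2 ∧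
      3 * (A * p ^ 2 + 2 * B * p * u + C * u ^ 2) ^ 2 ≤ 4 * (A * C - B ^ 2) := by
  induction hn : A.toNat using Nat.strong_induction_on generalizing A B C with
  | _ n ih =>
  obtain ⟨k, hk⟩ := exists_abs_two_mul_add_mul_le A B hA
  obtain ⟨B', hB'⟩ : ∃ B', B' = B + k * A := ⟨_, rfl⟩
  obtain ⟨C', hC'⟩ : ∃ C', C' = C + 2 * k * B + k ^ 2 * A := ⟨_, rfl⟩
  rw [← hB'] at hk
  have hdet : A * C' - B' ^ 2 = A * C - B ^ 2 := by rw [hB', hC']; ring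
  by_cases hle : A ≤ C'
  · refine ⟨1, 0, 0, 1, by norm_num, by linarith, ?_⟩
    have : A * A ≤ A * C' := mul_le_mul_of_nonneg_left hle hA.le
    ring_nf at *
    linarith
  · have hC'pos : 0 < C' := by
      refine pos_of_mul_pos_right (a := A) ?_ hA.le
      nlinarith [sq_nonneg B']
    obtain ⟨p, q, u, v, h1, h2, h3⟩ := ih C'.toNat (by omega) C' (-B') A hC'pos
      (by linarith [hdet]) rfl
    have key : A * (-u + k * p) ^ 2 + 2 * B * (-u + k * p) * p + C * p ^ 2 =
        C' * p ^ 2 + 2 * (-B') * p * u + A * u ^ 2 := by rw [hB', hC']; ring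
    refine ⟨-u + k * p, -v + k * q, p, q, by linarith, by rw [key]; exact h2, ?_⟩
    rw [key]
    linarith

/-- A positive definite integral ternary form of determinant one only takes values that are sums of
three squares. -/
theorem ternary_det_one_eq_sum_three_sq (a b c r s t : ℤ) (ha : 0 < a) (hab : 0 < a * b - t ^ 2)
    (hdet : a * b * c + 2 * r * s * t - a * r ^ 2 - b * s ^ 2 - c * t ^ 2 = 1) (x y z : ℤ) :
    ∃ p q w : ℤ, a * x ^ 2 + b * y ^ 2 + c * z ^ 2 + 2 * r * y * z + 2 * s * x * z + 2 * t * x * y =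
      p ^ 2 + q ^ 2 + w ^ 2 := by
  induction hn : a.toNat using Nat.strong_induction_on generalizing a b c r s t x y z with
  | _ n ih =>
  have hG : (a * b - t ^ 2) * (a * c - s ^ 2) - (a * r - t * s) ^ 2 = a := by
    linear_combination a * hdet
  obtain ⟨p, q, u, v, hpv, hpos, hle⟩ := exists_unimodular_binary_reduced (a * b - t ^ 2)
    (a * r - t * s) (a * c - s ^ 2) hab (by rw [hG]; exact ha)
  rw [hG] at hle
  obtain ⟨Y, Z, rfl, rfl⟩ : ∃ Y Z, y = p * Y + q * Z ∧ z = u * Y + v * Z :=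
    ⟨v * y - q * z, -u * y + p * z, by linear_combination -y * hpv, by linear_combination -z * hpv⟩
  obtain ⟨b₁, hb₁⟩ : ∃ b₁, b₁ = b * p ^ 2 + 2 * r * p * u + c * u ^ 2 := ⟨_, rfl⟩
  obtain ⟨c₁, hc₁⟩ : ∃ c₁, c₁ = b * q ^ 2 + 2 * r * q * v + c * v ^ 2 := ⟨_, rfl⟩
  obtain ⟨r₁, hr₁⟩ : ∃ r₁, r₁ = b * p * q + r * (p * v + q * u) + c * u * v := ⟨_, rfl⟩
  obtain ⟨t₁, ht₁⟩ : ∃ t₁, t₁ = t * p + s * u := ⟨_, rfl⟩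
  obtain ⟨s₁, hs₁⟩ : ∃ s₁, s₁ = t * q + s * v := ⟨_, rfl⟩
  have hdet₁ : a * b₁ * c₁ + 2 * r₁ * s₁ * t₁ - a * r₁ ^ 2 - b₁ * s₁ ^ 2 - c₁ * t₁ ^ 2 = 1 := by
    rw [hb₁, hc₁, hr₁, ht₁, hs₁]
    linear_combination (p * v - q * u) ^ 2 * hdet + (p * v - q * u + 1) * hpv
  have hA : (a * b - t ^ 2) * p ^ 2 + 2 * (a * r - t * s) * p * u + (a * c - s ^ 2) * u ^ 2 =
      a * b₁ - t₁ ^ 2 := by rw [hb₁, ht₁]; ring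
  rw [hA] at hpos hle
  have hform : a * x ^ 2 + b * (p * Y + q * Z) ^ 2 + c * (u * Y + v * Z) ^ 2 +
      2 * r * (p * Y + q * Z) * (u * Y + v * Z) + 2 * s * x * (u * Y + v * Z) +
      2 * t * x * (p * Y + q * Z) =
      a * x ^ 2 + b₁ * Y ^ 2 + c₁ * Z ^ 2 + 2 * r₁ * Y * Z + 2 * s₁ * x * Z + 2 * t₁ * x * Y := by
    rw [hb₁, hc₁, hr₁, ht₁, hs₁]; ring
  rw [hform]
  clear hform hA hb₁ hc₁ hr₁ ht₁ hs₁
  rcases (show a = 1 ∨ 2 ≤ a by omega) with rfl | ha2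
  · have hA1 : b₁ = 1 + t₁ ^ 2 := by
      have : 1 * b₁ - t₁ ^ 2 ≤ 1 := by nlinarith
      linarith
    have hC1 : c₁ = 1 + s₁ ^ 2 + (r₁ - t₁ * s₁) ^ 2 := by
      subst hA1
      linear_combination hdet₁
    refine ⟨x + t₁ * Y + s₁ * Z, Y + (r₁ - t₁ * s₁) * Z, Z, ?_⟩
    rw [hA1, hC1]; ring
  · obtain ⟨k, hk⟩ := exists_abs_two_mul_add_mul_le a t₁ ha
    obtain ⟨t₂, ht₂⟩ : ∃ t₂, t₂ = t₁ + k * a := ⟨_, rfl⟩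
    obtain ⟨b₂, hb₂⟩ : ∃ b₂, b₂ = b₁ + 2 * k * t₁ + k ^ 2 * a := ⟨_, rfl⟩
    rw [← ht₂] at hk
    have hA : a * b₂ - t₂ ^ 2 = a * b₁ - t₁ ^ 2 := by rw [ht₂, hb₂]; ring
    rw [← hA] at hpos hle
    have hb₂pos : 0 < b₂ := pos_of_mul_pos_right (a := a) (by nlinarith [sq_nonneg t₂]) ha.le
    have hlt : b₂ < a := by
      by_contra! hge
      have h1 : a * a ≤ a * b₂ := mul_le_mul_of_nonneg_left hge ha.le
      have h2 : 3 * a ^ 2 ≤ 4 * (a * b₂ - t₂ ^ 2) := by linarith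
      have h3 : 6 * a ≤ 4 * (a * b₂ - t₂ ^ 2) := by nlinarith
      nlinarith
    obtain ⟨P, Q, W, h⟩ := ih b₂.toNat (by omega) b₂ a c₁ s₁ (r₁ + k * s₁) t₂ hb₂pos
      (by linarith) (by rw [ht₂, hb₂]; linear_combination hdet₁) Y (x - k * Y) Z rfl
    refine ⟨P, Q, W, ?_⟩
    rw [← h, ht₂, hb₂]; ring

theorem sum_three_sq_of_dvd (n d x : ℤ) (hd : 0 < d) (hn : 0 < d * n - 1)
    (h : d * n - 1 ∣ x ^ 2 + d) : ∃ p q w : ℤ, n = p ^ 2 + q ^ 2 + w ^ 2 := by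
  obtain ⟨k, hk⟩ := h
  have hkpos : 0 < k := pos_of_mul_pos_right (a := d * n - 1) (by nlinarith [sq_nonneg x]) hn.le
  obtain ⟨p, q, w, h⟩ := ternary_det_one_eq_sum_three_sq k (d * n - 1) n 0 1 x hkpos
    (by linarith) (by linear_combination -n * hk) 0 0 1
  exact ⟨p, q, w, by rw [← h]; ring⟩

theorem exists_dvd_sq_add_of_jacobiSym_eq_one {p : ℕ} (hp : p.Prime) {d : ℤ}
    (h : J(-d | p) = 1) : ∃ x : ℤ, (p : ℤ) ∣ x ^ 2 + d := by
  have : Fact p.Prime := ⟨hp⟩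
  obtain ⟨r, hr⟩ := ZMod.isSquare_of_jacobiSym_eq_one h
  obtain ⟨x, rfl⟩ := ZMod.intCast_surjective r
  refine ⟨x, (ZMod.intCast_zmod_eq_zero_iff_dvd _ _).1 ?_⟩
  push_cast at hr ⊢
  linear_combination -hr

theorem sum_three_sq_of_mod_four_eq_two (n : ℕ) (hn : n % 4 = 2) :
    ∃ p q w : ℤ, (n : ℤ) = p ^ 2 + q ^ 2 + w ^ 2 := by
  have hcop : (n - 1).Coprime (4 * n) := by
    refine Nat.Coprime.mul_right ?_ ?_
    · rw [show 4 = 2 ^ 2 from rfl]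
      exact (Nat.coprime_two_right.2 (Nat.odd_iff.2 (by omega))).pow_right 2
    · exact (Nat.coprime_self_sub_left (by omega)).2 (Nat.coprime_one_left n)
  obtain ⟨p, hgt, hp, hmod⟩ := Nat.forall_exists_prime_gt_and_modEq n (by omega) hcop
  obtain ⟨j, hj⟩ := (Nat.modEq_iff_dvd' (by omega)).1 hmod.symm
  have hpn : p + 1 = (4 * j + 1) * n := by
    have : p = n - 1 + 4 * n * j := by omega
    rw [this, add_mul, one_mul, mul_right_comm]
    omega
  have hp4 : p % 4 = 1 := by
    have : (p + 1) % 4 = 2 := by rw [hpn, Nat.mul_mod, hn]; omega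
    omega
  have hpo : Odd p := Nat.odd_iff.2 (by omega)
  have hdo : Odd (4 * j + 1) := Nat.odd_iff.2 (by omega)
  have hJ : J(-((4 * j + 1 : ℕ) : ℤ) | p) = 1 := by
    rw [jacobiSym.neg _ hpo, ZMod.χ₄_nat_one_mod_four hp4, one_mul,
      jacobiSym.quadratic_reciprocity_one_mod_four' hdo hp4,
      jacobiSym.mod_left' (a₂ := -1), jacobiSym.at_neg_one hdo,
      ZMod.χ₄_nat_one_mod_four (by omega)]
    refine (Int.modEq_iff_dvd.2 ⟨n, ?_⟩).symm
    rw [sub_neg_eq_add]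
    exact_mod_cast hpn
  obtain ⟨x, hx⟩ := exists_dvd_sq_add_of_jacobiSym_eq_one hp hJ
  have hpz : (p : ℤ) = ((4 * j + 1 : ℕ) : ℤ) * n - 1 := by
    have : (p : ℤ) + 1 = ((4 * j + 1 : ℕ) : ℤ) * n := by exact_mod_cast hpn
    linarith
  refine sum_three_sq_of_dvd n ((4 * j + 1 : ℕ) : ℤ) x (by positivity) ?_ ?_
  · rw [← hpz]; exact_mod_cast hp.pos
  · rwa [← hpz]

theorem sum_three_sq_of_mod_eight (n : ℕ) (hn : n % 8 = 1 ∨ n % 8 = 3 ∨ n % 8 = 5) :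
    ∃ p q w : ℤ, (n : ℤ) = p ^ 2 + q ^ 2 + w ^ 2 := by
  obtain ⟨c, e, hc, he⟩ : ∃ c e : ℕ, c * n = 2 * e + 1 ∧
      (c = 1 ∧ n % 8 = 3 ∧ e % 4 = 1 ∨ c = 3 ∧ n % 8 = 1 ∧ e % 4 = 1 ∨
        c = 3 ∧ n % 8 = 5 ∧ e % 4 = 3) := by
    rcases hn with h | h | h
    · exact ⟨3, (3 * n - 1) / 2, by omega, by omega⟩
    · exact ⟨1, (n - 1) / 2, by omega, by omega⟩
    · exact ⟨3, (3 * n - 1) / 2, by omega, by omega⟩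
  have hcop : e.Coprime (4 * n) := by
    refine Nat.Coprime.mul_right ?_ ?_
    · rw [show 4 = 2 ^ 2 from rfl]
      exact (Nat.coprime_two_right.2 (Nat.odd_iff.2 (by omega))).pow_right 2
    · refine Nat.Coprime.coprime_mul_left_right (k := c) ?_
      rw [hc]
      simp
  obtain ⟨p, hgt, hp, hmod⟩ := Nat.forall_exists_prime_gt_and_modEq e (by omega) hcop
  obtain ⟨j, hj⟩ := (Nat.modEq_iff_dvd' (by omega)).1 hmod.symm
  have hpe : p = e + 4 * (n * j) := by rw [← mul_assoc]; omega
  have hpn : 2 * p + 1 = (8 * j + c) * n := by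
    rw [add_mul, hc, hpe]; ring
  obtain ⟨d, hd⟩ : ∃ d, d = 8 * j + c := ⟨_, rfl⟩
  rw [← hd] at hpn
  have hpo : Odd p := Nat.odd_iff.2 (by omega)
  have hdo : Odd d := Nat.odd_iff.2 (by omega)
  have hpz : 2 * (p : ℤ) = d * n - 1 := by
    have : 2 * (p : ℤ) + 1 = d * n := by exact_mod_cast hpn
    linarith
  have hneg2 : J(-2 | d) = 1 := by
    rw [jacobiSym.at_neg_two hdo, ZMod.χ₈'_nat_eq_if_mod_eight]
    have : d % 8 = 1 ∨ d % 8 = 3 := by omega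
    rw [if_neg (by omega), if_pos this]
  have hpd : J(p | d) = 1 := by
    have h : J(-2 * p | d) = 1 := by
      rw [jacobiSym.mod_left' (a₂ := 1), jacobiSym.one_left]
      exact Int.modEq_iff_dvd.2 ⟨n, by linarith⟩
    rwa [jacobiSym.mul_left, hneg2, one_mul] at h
  have hJ : J(-(d : ℤ) | p) = 1 := by
    rw [jacobiSym.neg _ hpo]
    rcases (show p % 4 = 1 ∨ p % 4 = 3 ∧ d % 4 = 3 by omega) with h | ⟨h, h'⟩
    · rw [ZMod.χ₄_nat_one_mod_four h, one_mul,
        jacobiSym.quadratic_reciprocity_one_mod_four' hdo h, hpd]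
    · rw [ZMod.χ₄_nat_three_mod_four h, jacobiSym.quadratic_reciprocity_three_mod_four h' h, hpd]
      norm_num
  obtain ⟨x, hx⟩ := exists_dvd_sq_add_of_jacobiSym_eq_one hp hJ
  obtain ⟨y, hy, hy2⟩ : ∃ y : ℤ, (p : ℤ) ∣ y ^ 2 + d ∧ (2 : ℤ) ∣ y ^ 2 + d := by
    have hdz : Odd (d : ℤ) := by exact_mod_cast hdo
    have hpz : Odd (p : ℤ) := by exact_mod_cast hpo
    rcases Int.even_or_odd x with he | ho
    · refine ⟨x + p, ?_, ((he.add_odd hpz).pow.add_odd hdz).two_dvd⟩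
      have : (x + p) ^ 2 + (d : ℤ) = x ^ 2 + d + p * (2 * x + p) := by ring
      rw [this]
      exact dvd_add hx (dvd_mul_right _ _)
    · exact ⟨x, hx, (ho.pow.add_odd hdz).two_dvd⟩
  refine sum_three_sq_of_dvd n d y (by exact_mod_cast hdo.pos) ?_ ?_
  · rw [← hpz]
    have := hp.pos
    positivity
  · rw [← hpz]
    refine IsCoprime.mul_dvd ?_ hy2 hy
    exact_mod_cast (Nat.coprime_two_left.2 hpo).isCoprime

/-- Legendre's three-square theorem. -/
theorem Nat.sum_three_sq (n : ℕ) (hn : ¬ ∃ k l : ℕ, n = 4 ^ k * (8 * l + 7)) :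
    ∃ p q w : ℤ, (n : ℤ) = p ^ 2 + q ^ 2 + w ^ 2 := by
  induction n using Nat.strong_induction_on with
  | _ n ih =>
  rcases Nat.eq_zero_or_pos n with rfl | hpos
  · exact ⟨0, 0, 0, by norm_num⟩
  by_cases h4 : n % 4 = 0
  · obtain ⟨m, rfl⟩ := Nat.dvd_of_mod_eq_zero h4
    obtain ⟨p, q, w, h⟩ := ih m (by omega) fun ⟨k, l, h⟩ => hn ⟨k + 1, l, by rw [h]; ring⟩
    exact ⟨2 * p, 2 * q, 2 * w, by push_cast; rw [h]; ring⟩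
  · have h7 : n % 8 ≠ 7 := fun h => hn ⟨0, n / 8, by omega⟩
    rcases (show n % 4 = 2 ∨ n % 8 = 1 ∨ n % 8 = 3 ∨ n % 8 = 5 by omega) with h | h
    · exact sum_three_sq_of_mod_four_eq_two n h
    · exact sum_three_sq_of_mod_eight n h

/-- Modulo 11 every isotropic line of a sum of three squares is a signed permutation of the line
spanned by `(1, 1, 3)`. -/
theorem ZMod.isotropic_three_sq_eleven : ∀ a b c : ZMod 11, a ^ 2 + b ^ 2 + c ^ 2 = 0 →
    b ^ 2 = a ^ 2 ∧ c ^ 2 = (3 * a) ^ 2 ∨ c ^ 2 = a ^ 2 ∧ b ^ 2 = (3 * a) ^ 2 ∨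
      c ^ 2 = b ^ 2 ∧ a ^ 2 = (3 * b) ^ 2 := by
  decide

theorem exists_sq_eq_add_mul_sq {a b : ℤ} (h : (b : ZMod 11) ^ 2 = (a : ZMod 11) ^ 2) :
    ∃ w : ℤ, b ^ 2 = (a + 11 * w) ^ 2 := by
  have : Fact (Nat.Prime 11) := ⟨by norm_num⟩
  rcases sq_eq_sq_iff_eq_or_eq_neg.1 h with h | h
  · obtain ⟨w, hw⟩ := (ZMod.intCast_eq_intCast_iff_dvd_sub a b 11).1 h.symm
    exact ⟨w, by push_cast at hw; rw [← hw]; ring⟩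
  · obtain ⟨w, hw⟩ := (ZMod.intCast_eq_intCast_iff_dvd_sub a (-b) 11).1
      (by rw [Int.cast_neg, h, neg_neg])
    exact ⟨w, by push_cast at hw; rw [← hw]; ring⟩

theorem exists_form_eq_of_eleven_mul_eq {m a b c : ℤ} (h : 11 * m = a ^ 2 + b ^ 2 + c ^ 2)
    (hb : (b : ZMod 11) ^ 2 = (a : ZMod 11) ^ 2) (hc : (c : ZMod 11) ^ 2 = (3 * a : ZMod 11) ^ 2) :
    ∃ x y z : ℤ, x ^ 2 + 2 * y ^ 2 + 2 * y * z + 6 * z ^ 2 = m := by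
  obtain ⟨z, hz⟩ := exists_sq_eq_add_mul_sq hb
  obtain ⟨w, hw⟩ := exists_sq_eq_add_mul_sq (a := 3 * a) (b := c) (by exact_mod_cast hc)
  refine ⟨a + z + 3 * w, 2 * z - w, -z, ?_⟩
  linarith

theorem exists_form_eq_of_eleven_mul_eq_sum_three_sq {m a b c : ℤ}
    (h : 11 * m = a ^ 2 + b ^ 2 + c ^ 2) :
    ∃ x y z : ℤ, x ^ 2 + 2 * y ^ 2 + 2 * y * z + 6 * z ^ 2 = m := by
  have h0 : (a : ZMod 11) ^ 2 + (b : ZMod 11) ^ 2 + (c : ZMod 11) ^ 2 = 0 := by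
    have := congrArg (Int.cast : ℤ → ZMod 11) h
    push_cast at this
    rw [← this, show (11 : ZMod 11) = 0 from rfl, zero_mul]
  rcases ZMod.isotropic_three_sq_eleven _ _ _ h0 with ⟨h1, h2⟩ | ⟨h1, h2⟩ | ⟨h1, h2⟩
  · exact exists_form_eq_of_eleven_mul_eq h h1 h2
  · exact exists_form_eq_of_eleven_mul_eq (by linarith : 11 * m = a ^ 2 + c ^ 2 + b ^ 2) h1 h2
  · exact exists_form_eq_of_eleven_mul_eq (by linarith : 11 * m = b ^ 2 + c ^ 2 + a ^ 2) h1 h2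

theorem ZMod.form_ne_five : ∀ x y z : ZMod 8,
    x ^ 2 + 2 * y ^ 2 + 2 * y * z + 6 * z ^ 2 ≠ 5 := by
  decide

theorem even_of_four_dvd_form {x y z : ℤ} (h : 4 ∣ x ^ 2 + 2 * y ^ 2 + 2 * y * z + 6 * z ^ 2) :
    2 ∣ x ∧ 2 ∣ y ∧ 2 ∣ z := by
  have key : ∀ x y z : ZMod 4, x ^ 2 + 2 * y ^ 2 + 2 * y * z + 6 * z ^ 2 = 0 →
      2 * x = 0 ∧ 2 * y = 0 ∧ 2 * z = 0 := by decide
  have h0 := (ZMod.intCast_zmod_eq_zero_iff_dvd _ 4).2 h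
  push_cast at h0
  have aux : ∀ t : ℤ, 2 * (t : ZMod 4) = 0 → 2 ∣ t := fun t ht => by
    have := (ZMod.intCast_zmod_eq_zero_iff_dvd (2 * t) 4).1 (by exact_mod_cast ht)
    push_cast at this
    omega
  obtain ⟨h1, h2, h3⟩ := key _ _ _ h0
  exact ⟨aux _ h1, aux _ h2, aux _ h3⟩

theorem form_ne_four_pow_mul (k l : ℕ) (x y z : ℤ) :
    x ^ 2 + 2 * y ^ 2 + 2 * y * z + 6 * z ^ 2 ≠ 4 ^ k * (8 * l + 5) := by
  induction k generalizing x y z with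
  | zero =>
    intro h
    have := congrArg (Int.cast : ℤ → ZMod 8) h
    push_cast at this
    rw [show (8 : ZMod 8) = 0 from rfl] at this
    exact ZMod.form_ne_five x y z (by simpa using this)
  | succ k ih =>
    intro h
    obtain ⟨⟨x, rfl⟩, ⟨y, rfl⟩, ⟨z, rfl⟩⟩ := even_of_four_dvd_form (x := x) (y := y) (z := z)
      ⟨4 ^ k * (8 * l + 5), by rw [h]; ring⟩
    refine ih x y z ?_
    rw [pow_succ 4 k] at h
    linarith

theorem stmt_1 (m : ℕ) (hm : 0 < m) :
    (∃ x y z : ℤ, x^2 + 2*y^2 + 2*y*z + 6*z^2 = (m : ℤ)) ↔ ¬ ∃ k l : ℕ, m = 4 ^ k * (8 * l + 5) := by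
  constructor
  · rintro ⟨x, y, z, h⟩ ⟨k, l, rfl⟩
    exact form_ne_four_pow_mul k l x y z (by rw [h]; push_cast; rfl)
  · intro h
    obtain ⟨a, b, c, habc⟩ := Nat.sum_three_sq (11 * m) fun ⟨k, l, hkl⟩ => by
      have hdvd : 11 ∣ 8 * l + 7 := by
        refine Nat.Coprime.dvd_of_dvd_mul_left (m := 4 ^ k) ?_ ⟨m, hkl.symm⟩
        exact Nat.Coprime.pow_right k (by norm_num)
      obtain ⟨t, ht⟩ := hdvd
      refine h ⟨k, t / 8, ?_⟩
      have ht8 : 8 * (t / 8) + 5 = t := by omega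
      rw [ht8]
      rw [ht] at hkl
      linarith
    push_cast at habc
    exact exists_form_eq_of_eleven_mul_eq_sum_three_sq habc
end

section
/- Let m be an odd positive integer. Then 4m is represented by the ternary quadratic form 2x^2 + 2xy + 2xz + 2y^2 + 2yz + 3z^2 if and only if m is represented by the same form. -/
/-- If `x ^ 2 + x * y + y ^ 2` is even, then so are `x` and `y`. -/
theorem Int.even_and_even_of_even_sq_add_mul_add_sq {x y : ℤ}
    (h : Even (x ^ 2 + x * y + y ^ 2)) : Even x ∧ Even y := by
  simp only [Int.even_add, Int.even_mul, Int.even_pow' two_ne_zero] at h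
  tauto

theorem stmt_4 (m : ℕ) (hm : 0 < m) (hodd : Odd m) :
    (∃ x y z : ℤ, 2*x^2 + 2*x*y + 2*x*z + 2*y^2 + 2*y*z + 3*z^2 = (4 * m : ℤ)) ↔ (∃ x y z : ℤ, 2*x^2 + 2*x*y + 2*x*z + 2*y^2 + 2*y*z + 3*z^2 = (m : ℤ)) := by
  constructor
  · rintro ⟨x, y, z, h⟩
    have hz : Even z := by
      have h3 : Even (3 * z ^ 2) :=
        ⟨2 * m - x ^ 2 - x * y - x * z - y ^ 2 - y * z, by linear_combination h⟩
      simpa [Int.even_mul, Int.even_pow, show ¬ Even (3 : ℤ) by decide] using h3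
    obtain ⟨w, rfl⟩ := hz
    have hxy : Even (x ^ 2 + x * y + y ^ 2) :=
      ⟨m - x * w - y * w - 3 * w ^ 2, by linarith⟩
    obtain ⟨⟨a, rfl⟩, ⟨b, rfl⟩⟩ := Int.even_and_even_of_even_sq_add_mul_add_sq hxy
    exact ⟨a, b, w, by linarith⟩
  · rintro ⟨x, y, z, h⟩
    exact ⟨2 * x, 2 * y, 2 * z, by linear_combination 4 * h⟩
end

section
/- If m = 7n for an integer n with n ≡ 3, 5, or 6 (mod 7), then m is not represented by the ternary quadratic form x^2 + 2y^2 + 2yz + 4z^2; that is, there are no integers x, y, z with x^2 + 2y^2 + 2yz + 4z^2 = 7n. -/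
/-- Since `-2` is not a square modulo `7`, the form `2a² + b²` is anisotropic modulo `7`. -/
theorem seven_dvd_of_dvd_two_mul_sq_add_sq {a b : ℤ} (h : (7 : ℤ) ∣ 2 * a ^ 2 + b ^ 2) :
    (7 : ℤ) ∣ a ∧ (7 : ℤ) ∣ b := by
  have key : ∀ u v : ZMod 7, 2 * u ^ 2 + v ^ 2 = 0 → u = 0 ∧ v = 0 := by decide
  have h7 := (ZMod.intCast_zmod_eq_zero_iff_dvd _ 7).2 h
  push_cast at h7
  obtain ⟨ha, hb⟩ := key _ _ h7
  exact ⟨(ZMod.intCast_zmod_eq_zero_iff_dvd a 7).1 ha, (ZMod.intCast_zmod_eq_zero_iff_dvd b 7).1 hb⟩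

theorem stmt_6 (n : ℤ) (hn : n % 7 = 3 ∨ n % 7 = 5 ∨ n % 7 = 6) :
    ¬ ∃ x y z : ℤ, x^2 + 2*y^2 + 2*y*z + 4*z^2 = 7 * n := by
  rintro ⟨x, y, z, h⟩
  obtain ⟨⟨a, rfl⟩, b, hb⟩ := seven_dvd_of_dvd_two_mul_sq_add_sq (a := x) (b := 2 * y + z)
    ⟨2 * n - z ^ 2, by linear_combination 2 * h⟩
  have hz : z ^ 2 = 2 * n - 7 * (2 * a ^ 2 + b ^ 2) := by
    apply mul_left_cancel₀ (by norm_num : (7 : ℤ) ≠ 0)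
    linear_combination 2 * h - (2 * y + z + 7 * b) * hb
  have hsq : z ^ 2 % 7 = 0 ∨ z ^ 2 % 7 = 1 ∨ z ^ 2 % 7 = 2 ∨ z ^ 2 % 7 = 4 := by
    have hr : z % 7 = 0 ∨ z % 7 = 1 ∨ z % 7 = 2 ∨ z % 7 = 3 ∨ z % 7 = 4 ∨ z % 7 = 5 ∨
        z % 7 = 6 := by omega
    rcases hr with hr | hr | hr | hr | hr | hr | hr <;> simp [pow_two, Int.mul_emod, hr]
  omega
end

section
/- A natural number m is represented by the ternary quadratic form x^2 + 2y^2 + 2yz + 6z^2 if and only if 4m is represented by the same form. -/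
/-- The form `y² + yz + 3z²` is anisotropic modulo `2`. -/
theorem even_and_even_of_even_sq_add_mul_add_three_mul_sq {y z : ℤ}
    (h : Even (y^2 + y*z + 3*z^2)) : Even y ∧ Even z := by
  have h3 : ¬ Even (3 : ℤ) := by decide
  simp only [Int.even_add, Int.even_mul, Int.even_pow, h3] at h
  tauto

theorem stmt_8 (m : ℕ) :
    (∃ x y z : ℤ, x^2 + 2*y^2 + 2*y*z + 6*z^2 = (m : ℤ)) ↔ (∃ x y z : ℤ, x^2 + 2*y^2 + 2*y*z + 6*z^2 = (4 * m : ℤ)) := by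
  constructor
  · rintro ⟨x, y, z, h⟩
    exact ⟨2*x, 2*y, 2*z, by linear_combination 4 * h⟩
  · rintro ⟨x, y, z, h⟩
    have hx : Even x := by
      have hx2 : Even (x^2) := ⟨2*m - y^2 - y*z - 3*z^2, by linear_combination h⟩
      exact (Int.even_pow.mp hx2).1
    obtain ⟨a, rfl⟩ := hx
    have hyz : Even (y^2 + y*z + 3*z^2) := ⟨m - a^2, by linarith⟩
    obtain ⟨⟨b, rfl⟩, ⟨c, rfl⟩⟩ := even_and_even_of_even_sq_add_mul_add_three_mul_sq hyz
    exact ⟨a, b, c, by linarith⟩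
end

section
/- If m = 11n where the integer n is a quadratic nonresidue modulo 11, then m is not represented by the ternary quadratic form x^2 + 3y^2 + 2yz + 4z^2; that is, there are no integers x, y, z with x^2 + 3y^2 + 2yz + 4z^2 = 11n. -/
/-- The form `3 * x ^ 2 + w ^ 2` is anisotropic modulo `11`, because `-3` is a nonresidue. -/
theorem eleven_dvd_of_dvd_three_mul_sq_add_sq {x w : ℤ} (h : (11 : ℤ) ∣ 3 * x ^ 2 + w ^ 2) :
    (11 : ℤ) ∣ x ∧ (11 : ℤ) ∣ w := by
  have anisotropic : ∀ a b : ZMod 11, 3 * a ^ 2 + b ^ 2 = 0 → a = 0 ∧ b = 0 := by decide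
  have hzero := (ZMod.intCast_zmod_eq_zero_iff_dvd (3 * x ^ 2 + w ^ 2) 11).mpr (mod_cast h)
  push_cast at hzero
  obtain ⟨hx, hw⟩ := anisotropic x w hzero
  exact ⟨mod_cast (ZMod.intCast_zmod_eq_zero_iff_dvd x 11).mp hx,
    mod_cast (ZMod.intCast_zmod_eq_zero_iff_dvd w 11).mp hw⟩

theorem stmt_10 (n : ℤ) (hn : ¬ ∃ t : ℤ, t^2 ≡ n [ZMOD 11]) :
    ¬ ∃ x y z : ℤ, x^2 + 3*y^2 + 2*y*z + 4*z^2 = 11 * n := by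
  rintro ⟨x, y, z, h⟩
  obtain ⟨⟨a, rfl⟩, b, hb⟩ := eleven_dvd_of_dvd_three_mul_sq_add_sq
    (x := x) (w := 3 * y + z) ⟨3 * n - z ^ 2, by linear_combination 3 * h⟩
  obtain rfl : z = 11 * b - 3 * y := by linarith
  refine hn ⟨5 * y, Int.modEq_iff_dvd.mpr ⟨a ^ 2 - 2 * y ^ 2 - 2 * b * y + 4 * b ^ 2, ?_⟩⟩
  linarith
end

section
/- Let m be an even positive integer. Then m is represented by the ternary quadratic form x^2 + 3y^2 + 2yz + 5z^2 if and only if 4m is represented by the same form. -/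
/-- If `8` divides a value of `x² + 3y² + 2yz + 5z²`, then all three variables are even. -/
lemma even_of_eight_dvd_form {x y z : ℤ} (h : 8 ∣ x^2 + 3*y^2 + 2*y*z + 5*z^2) :
    2 ∣ x ∧ 2 ∣ y ∧ 2 ∣ z := by
  have residues : ∀ a b c : ZMod 8, a^2 + 3*b^2 + 2*b*c + 5*c^2 = 0 →
      4 * a = 0 ∧ 4 * b = 0 ∧ 4 * c = 0 := by decide
  have h8 : (x : ZMod 8)^2 + 3*(y : ZMod 8)^2 + 2*(y : ZMod 8)*(z : ZMod 8)
      + 5*(z : ZMod 8)^2 = 0 := by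
    exact_mod_cast (ZMod.intCast_zmod_eq_zero_iff_dvd _ 8).2 (by exact_mod_cast h)
  have two_dvd : ∀ a : ℤ, 4 * (a : ZMod 8) = 0 → 2 ∣ a := by
    intro a ha
    have : ((8 : ℕ) : ℤ) ∣ 4 * a := (ZMod.intCast_zmod_eq_zero_iff_dvd _ 8).1 (by exact_mod_cast ha)
    omega
  obtain ⟨hx, hy, hz⟩ := residues _ _ _ h8
  exact ⟨two_dvd x hx, two_dvd y hy, two_dvd z hz⟩

theorem stmt_12 (m : ℕ) (hm : 0 < m) (he : Even m) :
    (∃ x y z : ℤ, x^2 + 3*y^2 + 2*y*z + 5*z^2 = (m : ℤ)) ↔ (∃ x y z : ℤ, x^2 + 3*y^2 + 2*y*z + 5*z^2 = (4 * m : ℤ)) := by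
  constructor
  · rintro ⟨x, y, z, h⟩
    exact ⟨2 * x, 2 * y, 2 * z, by linear_combination 4 * h⟩
  · rintro ⟨x, y, z, h⟩
    have h8 : 8 ∣ x^2 + 3*y^2 + 2*y*z + 5*z^2 := by
      rw [h]
      obtain ⟨k, rfl⟩ := he
      exact ⟨k, by push_cast; ring⟩
    obtain ⟨⟨a, rfl⟩, ⟨b, rfl⟩, ⟨c, rfl⟩⟩ := even_of_eight_dvd_form h8
    exact ⟨a, b, c, by linarith⟩
end

section
/- If m = 7n where the integer n is a quadratic nonresidue modulo 7, then m is not represented by the ternary quadratic form x^2 + 2y^2 + 7z^2; that is, there are no integers x, y, z with x^2 + 2y^2 + 7z^2 = 7n. -/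
theorem seven_dvd_of_dvd_sq_add_two_mul_sq {x y : ℤ} (h : (7 : ℤ) ∣ x^2 + 2*y^2) :
    (7 : ℤ) ∣ x ∧ (7 : ℤ) ∣ y := by
  have key : ∀ a b : ZMod 7, a^2 + 2*b^2 = 0 → a = 0 ∧ b = 0 := by decide
  have h' := (ZMod.intCast_zmod_eq_zero_iff_dvd (x^2 + 2*y^2) 7).2 (by exact_mod_cast h)
  push_cast at h'
  obtain ⟨hx, hy⟩ := key _ _ h'
  exact ⟨by exact_mod_cast (ZMod.intCast_zmod_eq_zero_iff_dvd x 7).1 hx,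
    by exact_mod_cast (ZMod.intCast_zmod_eq_zero_iff_dvd y 7).1 hy⟩

theorem stmt_14 (n : ℤ) (hn : ¬ ∃ t : ℤ, t^2 ≡ n [ZMOD 7]) :
    ¬ ∃ x y z : ℤ, x^2 + 2*y^2 + 7*z^2 = 7 * n := by
  rintro ⟨x, y, z, h⟩
  obtain ⟨⟨a, rfl⟩, ⟨b, rfl⟩⟩ :=
    seven_dvd_of_dvd_sq_add_two_mul_sq (x := x) (y := y) ⟨n - z^2, by linarith⟩
  exact hn ⟨z, Int.modEq_iff_dvd.2 ⟨a^2 + 2*b^2, by linarith⟩⟩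
end

section
/- If m = 23n where the integer n is a quadratic nonresidue modulo 23, then m is not represented by the ternary quadratic form x^2 + 2y^2 + 2yz + 12z^2; that is, there are no integers x, y, z with x^2 + 2y^2 + 2yz + 12z^2 = 23n. -/
theorem dvd_of_dvd_two_mul_sq_add_sq {x w : ℤ} (h : (23 : ℤ) ∣ 2 * x ^ 2 + w ^ 2) :
    (23 : ℤ) ∣ x ∧ (23 : ℤ) ∣ w := by
  have key : ∀ a b : ZMod 23, 2 * a ^ 2 + b ^ 2 = 0 → a = 0 ∧ b = 0 := by decide +kernel
  have h' := (ZMod.intCast_zmod_eq_zero_iff_dvd _ 23).2 (by exact_mod_cast h)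
  push_cast at h'
  obtain ⟨hx, hw⟩ := key _ _ h'
  exact ⟨by exact_mod_cast (ZMod.intCast_zmod_eq_zero_iff_dvd x 23).1 hx,
    by exact_mod_cast (ZMod.intCast_zmod_eq_zero_iff_dvd w 23).1 hw⟩

theorem stmt_17 (n : ℤ) (hn : ¬ ∃ t : ℤ, t^2 ≡ n [ZMOD 23]) :
    ¬ ∃ x y z : ℤ, x^2 + 2*y^2 + 2*y*z + 12*z^2 = 23 * n := by
  rintro ⟨x, y, z, h⟩
  obtain ⟨⟨a, ha⟩, b, hb⟩ := dvd_of_dvd_two_mul_sq_add_sq (x := x) (w := 2 * y + z)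
    ⟨2 * n - z ^ 2, by linear_combination 2 * h⟩
  have h2 : 2 * n = 46 * a ^ 2 + 23 * b ^ 2 + z ^ 2 := by
    have : 23 * (2 * n) = 23 * (46 * a ^ 2 + 23 * b ^ 2 + z ^ 2) := by
      linear_combination (-2) * h + 2 * (x + 23 * a) * ha + (2 * y + z + 23 * b) * hb
    linarith
  exact hn ⟨14 * z, Int.modEq_iff_dvd.2
    ⟨392 * a ^ 2 + 196 * b ^ 2 - 17 * n, by linear_combination 196 * h2⟩⟩
end

section
/- If m = 23n where the integer n is a quadratic nonresidue modulo 23, then m is not represented by the ternary quadratic form x^2 + 3y^2 + 2yz + 8z^2; that is, there are no integers x, y, z with x^2 + 3y^2 + 2yz + 8z^2 = 23n. -/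
/-- The binary form `3 x² + w²` is anisotropic modulo `23`, since `-3` is not a square there. -/
lemma dvd_of_dvd_three_mul_sq_add_sq {x w : ℤ} (h : (23 : ℤ) ∣ 3 * x ^ 2 + w ^ 2) :
    (23 : ℤ) ∣ x ∧ (23 : ℤ) ∣ w := by
  have key : ∀ a b : ZMod 23, 3 * a ^ 2 + b ^ 2 = 0 → a = 0 ∧ b = 0 := by decide +kernel
  have h' := (ZMod.intCast_zmod_eq_zero_iff_dvd _ 23).2 h
  push_cast at h'
  obtain ⟨hx, hw⟩ := key _ _ h'
  exact ⟨(ZMod.intCast_zmod_eq_zero_iff_dvd _ 23).1 hx, (ZMod.intCast_zmod_eq_zero_iff_dvd _ 23).1 hw⟩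

theorem stmt_18 (n : ℤ) (hn : ¬ ∃ t : ℤ, t^2 ≡ n [ZMOD 23]) :
    ¬ ∃ x y z : ℤ, x^2 + 3*y^2 + 2*y*z + 8*z^2 = 23 * n := by
  rintro ⟨x, y, z, h⟩
  have hdvd : (23 : ℤ) ∣ 3 * x ^ 2 + (3 * y + z) ^ 2 := ⟨3 * n - z ^ 2, by linear_combination 3 * h⟩
  obtain ⟨⟨a, ha⟩, b, hb⟩ := dvd_of_dvd_three_mul_sq_add_sq hdvd
  have hz : 3 * n = z ^ 2 + 23 * (3 * a ^ 2 + b ^ 2) := by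
    have hsum : 3 * x ^ 2 + (3 * y + z) ^ 2 = 23 * (3 * n - z ^ 2) := by linear_combination 3 * h
    rw [ha, hb] at hsum
    linarith
  refine hn ⟨10 * z, Int.modEq_iff_dvd.2 ⟨8 * (3 * a ^ 2 + b ^ 2) - 4 * z ^ 2 - n, ?_⟩⟩
  linear_combination 8 * hz
end

section
/- If m = 23n where the integer n is a quadratic nonresidue modulo 23, then m is not represented by the ternary quadratic form x^2 + 4y^2 + 2yz + 6z^2; that is, there are no integers x, y, z with x^2 + 4y^2 + 2yz + 6z^2 = 23n. -/
theorem ZMod.eq_zero_of_sq_add_sq_eq_zero_twentyThree :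
    ∀ a b : ZMod 23, a ^ 2 + b ^ 2 = 0 → a = 0 ∧ b = 0 := by
  set_option maxRecDepth 100000 in decide

theorem Int.dvd_of_twentyThree_dvd_sq_add_sq {a b : ℤ} (h : 23 ∣ a ^ 2 + b ^ 2) :
    23 ∣ a ∧ 23 ∣ b := by
  have h' : (a : ZMod 23) ^ 2 + (b : ZMod 23) ^ 2 = 0 := by
    have := (ZMod.intCast_zmod_eq_zero_iff_dvd _ 23).2 h
    push_cast at this
    exact this
  obtain ⟨ha, hb⟩ := ZMod.eq_zero_of_sq_add_sq_eq_zero_twentyThree _ _ h'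
  exact ⟨by exact_mod_cast (ZMod.intCast_zmod_eq_zero_iff_dvd a 23).1 ha,
    by exact_mod_cast (ZMod.intCast_zmod_eq_zero_iff_dvd b 23).1 hb⟩

theorem stmt_19 (n : ℤ) (hn : ¬ ∃ t : ℤ, t^2 ≡ n [ZMOD 23]) :
    ¬ ∃ x y z : ℤ, x^2 + 4*y^2 + 2*y*z + 6*z^2 = 23 * n := by
  rintro ⟨x, y, z, h⟩
  obtain ⟨⟨a, ha⟩, w, hw⟩ := Int.dvd_of_twentyThree_dvd_sq_add_sq (a := 2 * x) (b := 4 * y + z)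
    ⟨4 * n - z ^ 2, by linear_combination 4 * h⟩
  obtain ⟨c, rfl⟩ : (23 : ℤ) ∣ x := by omega
  obtain rfl : z = 23 * w - 4 * y := by linarith
  refine hn ⟨2 * y, Int.modEq_iff_dvd.2 ⟨c ^ 2 - 2 * y * w + 6 * w ^ 2, ?_⟩⟩
  linarith
end
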